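/- Let n ≥ 2 and d ≥ 1, and let A_1,…,A_t be finite sets of nonzero polynomials in ℤ[x_1,…,x_n], each polynomial of degree at most d in every variable, with |A_1| + ⋯ + |A_t| ≤ m. For each i let E_i = {f_i} ⊆ A_i be a singleton with f_i of positive degree in x_n. Then for any choice of irreducible bases B_i for the primitive parts of A_i and irreducible bases F_i ⊆ B_i for the primitive parts of E_i, the TTICAD projection P_𝓔(𝓐) has the (M, 2d²)-property with M = ⌊(3m+1)/2⌋ + t(t−1)/2. -/

import Mathlib

open Polynomial
open scoped Classical

noncomputable section

/-- `Rk k` is the coefficient ring `ℤ[x_1,…,x_{n-1}]` (with `k = n - 1`);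
polynomials in `ℤ[x_1,…,x_n]` are regarded as elements of `Polynomial (Rk k)`,
univariate in `x_n`. -/
abbrev Rk (k : ℕ) : Type := MvPolynomial (Fin k) ℤ

/-- The degree of `P ∈ ℤ[x_1,…,x_n]` in the variable `x_i`, `i ≤ n-1`. -/
def degX {k : ℕ} (P : Polynomial (Rk k)) (i : Fin k) : ℕ :=
  P.support.sup fun j => (P.coeff j).degreeOf i

/-- The combined degree of the finite set `S ⊆ ℤ[x_1,…,x_n]` (the maximum over all
variables of the degree of the product of the elements of `S`) is at most `d`. -/
def combDegLE {k : ℕ} (S : Finset (Polynomial (Rk k))) (d : ℕ) : Prop :=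
  (S.prod id).natDegree ≤ d ∧ ∀ i : Fin k, degX (S.prod id) i ≤ d

/-- The `(m,d)`-property for finite sets of polynomials in `ℤ[x_1,…,x_n]`:
the set can be partitioned into at most `m` subsets, each of combined degree at most `d`. -/
def HasMD {k : ℕ} (m d : ℕ) (A : Finset (Polynomial (Rk k))) : Prop :=
  ∃ Part : Finset (Finset (Polynomial (Rk k))),
    Part.card ≤ m ∧ (∀ S ∈ Part, ∀ T ∈ Part, S ≠ T → Disjoint S T) ∧
    Part.sup id = A ∧ ∀ S ∈ Part, combDegLE S d

/-- Combined degree at most `d` for finite sets of polynomials in `ℤ[x_1,…,x_{n-1}]`. -/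
def mvCombDegLE {k : ℕ} (S : Finset (Rk k)) (d : ℕ) : Prop :=
  ∀ i : Fin k, (S.prod id).degreeOf i ≤ d

/-- The `(m,d)`-property for finite sets of polynomials in `ℤ[x_1,…,x_{n-1}]`. -/
def mvHasMD {k : ℕ} (m d : ℕ) (A : Finset (Rk k)) : Prop :=
  ∃ Part : Finset (Finset (Rk k)),
    Part.card ≤ m ∧ (∀ S ∈ Part, ∀ T ∈ Part, S ≠ T → Disjoint S T) ∧
    Part.sup id = A ∧ ∀ S ∈ Part, mvCombDegLE S d

/-- The Sylvester matrix of `f` and `g` with respect to `x_n`. -/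
def sylvesterMat {k : ℕ} (f g : Polynomial (Rk k)) :
    Matrix (Fin (g.natDegree + f.natDegree)) (Fin (g.natDegree + f.natDegree)) (Rk k) :=
  Matrix.of fun i j =>
    if (i : ℕ) < g.natDegree then
      (if (i : ℕ) ≤ (j : ℕ) ∧ (j : ℕ) ≤ (i : ℕ) + f.natDegree then
        f.coeff (f.natDegree + (i : ℕ) - (j : ℕ)) else 0)
    else
      (if (i : ℕ) - g.natDegree ≤ (j : ℕ) ∧ (j : ℕ) ≤ (i : ℕ) then
        g.coeff ((i : ℕ) - (j : ℕ)) else 0)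

/-- The resultant `res_{x_n}(f,g)`, the determinant of the Sylvester matrix. -/
def resX {k : ℕ} (f g : Polynomial (Rk k)) : Rk k := (sylvesterMat f g).det

/-- The discriminant of `f` (of degree `δ ≥ 1` in `x_n`): the element `D` satisfying
`ldcf(f) * D = (-1)^(δ(δ-1)/2) * res_{x_n}(f, f')`. -/
def discX {k : ℕ} (f : Polynomial (Rk k)) : Rk k :=
  if h : ∃ D : Rk k, f.leadingCoeff * D =
      (-1 : Rk k) ^ (f.natDegree * (f.natDegree - 1) / 2) * resX f (derivative f)
  then h.choose else 0

/-- A choice of content and primitive part of `f` over `Rk k`. -/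
def contPair {k : ℕ} (f : Polynomial (Rk k)) : Rk k × Polynomial (Rk k) :=
  if h : ∃ p : Rk k × Polynomial (Rk k), f = Polynomial.C p.1 * p.2 ∧ p.2.IsPrimitive
  then h.choose else (0, 0)

/-- The content of `f` over `Rk k` (determined up to sign). -/
def contX {k : ℕ} (f : Polynomial (Rk k)) : Rk k := (contPair f).1

/-- The primitive part of `f` over `Rk k` (determined up to sign). -/
def primX {k : ℕ} (f : Polynomial (Rk k)) : Polynomial (Rk k) := (contPair f).2

/-- An irreducible basis: a finite set of irreducible polynomials of positive degree
in `x_n` that are pairwise relatively prime. -/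
def IsIrredBasis {k : ℕ} (B : Finset (Polynomial (Rk k))) : Prop :=
  (∀ b ∈ B, 0 < b.natDegree ∧ Irreducible b) ∧
  ∀ b ∈ B, ∀ b' ∈ B, b ≠ b' → IsRelPrime b b'

/-- `B` is an irreducible basis for the primitive parts of `A`: an irreducible basis,
each element of which divides some element of `A`, such that the primitive part of each
element of `A` of positive degree in `x_n` is, up to sign, a product of powers of
elements of `B`. -/
def IsBasisForPrim {k : ℕ} (B A : Finset (Polynomial (Rk k))) : Prop :=
  IsIrredBasis B ∧ (∀ b ∈ B, ∃ a ∈ A, b ∣ a) ∧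
  ∀ a ∈ A, 0 < a.natDegree →
    ∃ e : Polynomial (Rk k) → ℕ,
      primX a = ∏ b ∈ B, b ^ e b ∨ primX a = -∏ b ∈ B, b ^ e b

/-- The (nonzero) `x_n`-coefficients of `f`, as a finite set. -/
def coeffFinset {k : ℕ} (f : Polynomial (Rk k)) : Finset (Rk k) := f.support.image f.coeff

/-- `coeff(B)`: all `x_n`-coefficients of elements of `B`. -/
def coeffsB {k : ℕ} (B : Finset (Polynomial (Rk k))) : Finset (Rk k) := B.biUnion coeffFinset

/-- `disc(B)`. -/
def discB {k : ℕ} (B : Finset (Polynomial (Rk k))) : Finset (Rk k) := B.image discX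

/-- `res(B) = {res(f,g) : f ≠ g ∈ B}`. -/
def resB {k : ℕ} (B : Finset (Polynomial (Rk k))) : Finset (Rk k) :=
  ((B ×ˢ B).filter fun p => p.1 ≠ p.2).image fun p => resX p.1 p.2

/-- `cont(A)`. -/
def contA {k : ℕ} (A : Finset (Polynomial (Rk k))) : Finset (Rk k) := A.image contX

/-- `P(B) = coeff(B) ∪ disc(B) ∪ res(B)`. -/
def projP {k : ℕ} (B : Finset (Polynomial (Rk k))) : Finset (Rk k) :=
  coeffsB B ∪ discB B ∪ resB B

/-- `{res(f,g) : f ∈ F, g ∈ G}`. -/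
def crossRes {k : ℕ} (F G : Finset (Polynomial (Rk k))) : Finset (Rk k) :=
  (F ×ˢ G).image fun p => resX p.1 p.2

/-- The cross resultant set `RES×(𝓕)`. -/
def RESx {k t : ℕ} (F : Fin t → Finset (Polynomial (Rk k))) : Finset (Rk k) :=
  ((Finset.univ : Finset (Fin t × Fin t)).filter fun p => p.1 < p.2).biUnion fun p =>
    ((F p.1 ×ˢ F p.2).filter fun q => q.1 ≠ q.2).image fun q => resX q.1 q.2

/-- The TTICAD projection `P_𝓔(𝓐) = ⋃ᵢ cont(Aᵢ) ∪ ⋃ᵢ P_{Fᵢ}(Bᵢ) ∪ RES×(𝓕)`. -/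
def ttiProj {k t : ℕ} (A B F : Fin t → Finset (Polynomial (Rk k))) : Finset (Rk k) :=
  (Finset.univ.biUnion fun i => contA (A i)) ∪
    (Finset.univ.biUnion fun i => projP (F i) ∪ crossRes (F i) (B i \ F i)) ∪
    RESx F

section DegreeInCoefficientVariables

variable {k : ℕ}

lemma degreeOf_coeff_le_degX (P : Polynomial (Rk k)) (v : Fin k) (j : ℕ) :
    (P.coeff j).degreeOf v ≤ degX P v := by
  by_cases h : j ∈ P.support
  · exact Finset.le_sup (f := fun j => (P.coeff j).degreeOf v) h
  · rw [Polynomial.notMem_support_iff.mp h, MvPolynomial.degreeOf_zero]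
    exact Nat.zero_le _

lemma degX_C (c : Rk k) (v : Fin k) : degX (C c) v = c.degreeOf v := by
  apply le_antisymm
  · refine Finset.sup_le fun j _ => ?_
    rw [coeff_C]
    split_ifs <;> simp
  · simpa using degreeOf_coeff_le_degX (C c) v 0

lemma degX_finSuccEquiv (p : MvPolynomial (Fin (k + 1)) ℤ) (v : Fin k) :
    degX (MvPolynomial.finSuccEquiv ℤ k p) v = p.degreeOf v.succ := by
  apply le_antisymm
  · exact Finset.sup_le fun j _ => MvPolynomial.degreeOf_coeff_finSuccEquiv p v j
  · rw [MvPolynomial.degreeOf_le_iff]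
    intro m hm
    rw [← Finsupp.cons_tail m] at hm
    have h := MvPolynomial.mem_support_coeff_finSuccEquiv.mpr hm
    exact (MvPolynomial.monomial_le_degreeOf v h).trans (degreeOf_coeff_le_degX _ v _)

lemma degX_mul {P Q : Polynomial (Rk k)} (hP : P ≠ 0) (hQ : Q ≠ 0) (v : Fin k) :
    degX (P * Q) v = degX P v + degX Q v := by
  obtain ⟨p, rfl⟩ := (MvPolynomial.finSuccEquiv ℤ k).surjective P
  obtain ⟨q, rfl⟩ := (MvPolynomial.finSuccEquiv ℤ k).surjective Q
  rw [← map_mul]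
  simp only [degX_finSuccEquiv]
  exact MvPolynomial.degreeOf_mul_eq (by rintro rfl; simp at hP) (by rintro rfl; simp at hQ)

lemma degX_prod (S : Finset (Polynomial (Rk k))) (hS : ∀ b ∈ S, b ≠ 0) (v : Fin k) :
    degX (∏ b ∈ S, b) v = ∑ b ∈ S, degX b v := by
  induction S using Finset.induction_on with
  | empty => simpa using degX_C (1 : Rk k) v
  | insert a s ha ih =>
    have hs : ∀ b ∈ s, b ≠ 0 := fun b hb => hS b (Finset.mem_insert_of_mem hb)
    rw [Finset.prod_insert ha, Finset.sum_insert ha,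
      degX_mul (hS a (Finset.mem_insert_self a s)) (Finset.prod_ne_zero_iff.mpr hs), ih hs]

lemma degX_derivative_le (P : Polynomial (Rk k)) (v : Fin k) :
    degX (derivative P) v ≤ degX P v := by
  refine Finset.sup_le fun j _ => ?_
  have hC : ((j : Rk k) + 1) = MvPolynomial.C ((j : ℤ) + 1) := by simp
  rw [coeff_derivative, hC]
  exact (MvPolynomial.degreeOf_mul_C_le _ _ _).trans (degreeOf_coeff_le_degX P v _)

end DegreeInCoefficientVariables

section Resultant

variable {k : ℕ}

lemma degreeOf_sylvesterMat_le (p q : Polynomial (Rk k)) (v : Fin k)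
    (i j : Fin (q.natDegree + p.natDegree)) :
    (sylvesterMat p q i j).degreeOf v ≤
      if (i : ℕ) < q.natDegree then degX p v else degX q v := by
  simp only [sylvesterMat, Matrix.of_apply]
  split_ifs <;> first | exact degreeOf_coeff_le_degX _ v _ | simp

lemma degreeOf_resX_le (p q : Polynomial (Rk k)) (v : Fin k) :
    (resX p q).degreeOf v ≤ q.natDegree * degX p v + p.natDegree * degX q v := by
  rw [resX, Matrix.det_apply]
  refine (MvPolynomial.degreeOf_sum_le v _ _).trans (Finset.sup_le fun σ _ => ?_)
  have hsign : ∀ x : Rk k, (Equiv.Perm.sign σ • x).degreeOf v = x.degreeOf v := by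
    intro x
    rcases Int.units_eq_one_or (Equiv.Perm.sign σ) with h | h <;>
      simp [h, MvPolynomial.degreeOf_neg]
  rw [hsign, ← Equiv.prod_comp σ⁻¹]
  refine (MvPolynomial.degreeOf_prod_le v _ _).trans ?_
  refine (Finset.sum_le_sum fun i _ => degreeOf_sylvesterMat_le p q v _ _).trans ?_
  simp [Fin.sum_univ_add]

/-- The leading coefficient and the discriminant of `b` together have degree at most that of
`res(b, b')`. -/
lemma degreeOf_discX_add_leadingCoeff_le (b : Polynomial (Rk k)) (hb : 0 < b.natDegree)
    (v : Fin k) :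
    (discX b).degreeOf v + b.leadingCoeff.degreeOf v ≤ 2 * (b.natDegree * degX b v) := by
  have hlc : b.leadingCoeff.degreeOf v ≤ b.natDegree * degX b v :=
    (degreeOf_coeff_le_degX b v _).trans (Nat.le_mul_of_pos_left _ hb)
  by_cases hD : discX b = 0
  · rw [hD, MvPolynomial.degreeOf_zero]
    omega
  have hex : ∃ D : Rk k, b.leadingCoeff * D =
      (-1 : Rk k) ^ (b.natDegree * (b.natDegree - 1) / 2) * resX b (derivative b) := by
    by_contra h
    exact hD (by rw [discX, dif_neg h])
  have hspec : b.leadingCoeff * discX b =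
      (-1 : Rk k) ^ (b.natDegree * (b.natDegree - 1) / 2) * resX b (derivative b) := by
    rw [discX, dif_pos hex]
    exact hex.choose_spec
  have hlc0 : b.leadingCoeff ≠ 0 := by
    rw [Ne, leadingCoeff_eq_zero]
    rintro rfl
    simp at hb
  have hdeg := congrArg (MvPolynomial.degreeOf v) hspec
  rw [MvPolynomial.degreeOf_mul_eq hlc0 hD] at hdeg
  have hsign : ((-1 : Rk k) ^ (b.natDegree * (b.natDegree - 1) / 2) *
      resX b (derivative b)).degreeOf v = (resX b (derivative b)).degreeOf v := by
    rcases neg_one_pow_eq_or (Rk k) (b.natDegree * (b.natDegree - 1) / 2) with h | h <;>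
      simp [h, MvPolynomial.degreeOf_neg]
  have hres := degreeOf_resX_le b (derivative b) v
  have h₁ : (derivative b).natDegree * degX b v ≤ b.natDegree * degX b v :=
    Nat.mul_le_mul_right _ ((natDegree_derivative_le b).trans (Nat.sub_le _ _))
  have h₂ : b.natDegree * degX (derivative b) v ≤ b.natDegree * degX b v :=
    Nat.mul_le_mul_left _ (degX_derivative_le b v)
  omega

end Resultant

section ContentAndPrimitivePart

variable {k : ℕ}

lemma eq_C_contX_mul_primX (a : Polynomial (Rk k)) : a = C (contX a) * primX a := by
  have hex : ∃ p : Rk k × Polynomial (Rk k), a = C p.1 * p.2 ∧ p.2.IsPrimitive := by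
    let _ : NormalizedGCDMonoid (Rk k) := Classical.choice inferInstance
    exact ⟨(a.content, a.primPart), a.eq_C_content_mul_primPart, a.isPrimitive_primPart⟩
  rw [contX, primX, contPair, dif_pos hex]
  exact hex.choose_spec.1

lemma contX_ne_zero {a : Polynomial (Rk k)} (ha : a ≠ 0) : contX a ≠ 0 := by
  intro h
  exact ha (by rw [eq_C_contX_mul_primX a, h, C_0, zero_mul])

lemma primX_ne_zero {a : Polynomial (Rk k)} (ha : a ≠ 0) : primX a ≠ 0 := by
  intro h
  exact ha (by rw [eq_C_contX_mul_primX a, h, mul_zero])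

lemma Irreducible.dvd_primX {a b : Polynomial (Rk k)} (ha : a ≠ 0) (hb : Irreducible b)
    (hpos : 0 < b.natDegree) (hba : b ∣ a) : b ∣ primX a := by
  rw [eq_C_contX_mul_primX a] at hba
  refine (hb.prime.dvd_or_dvd hba).resolve_left fun h => ?_
  have := natDegree_le_of_dvd h (C_ne_zero.mpr (contX_ne_zero ha))
  rw [natDegree_C] at this
  omega

/-- Distinct basis elements dividing `a` have total degree at most that of `a` in the main
variable, and, together with the content of `a`, in every other variable. -/
lemma IsIrredBasis.degree_bounds {S : Finset (Polynomial (Rk k))} (hS : IsIrredBasis S)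
    {a : Polynomial (Rk k)} (ha : a ≠ 0) (hdvd : ∀ b ∈ S, b ∣ a) :
    ∑ b ∈ S, b.natDegree ≤ a.natDegree ∧
      ∀ v, (contX a).degreeOf v + ∑ b ∈ S, degX b v ≤ degX a v := by
  have hne : ∀ b ∈ S, b ≠ 0 := fun b hb => (hS.1 b hb).2.ne_zero
  have hprod : ∏ b ∈ S, b ∣ primX a :=
    Finset.prod_dvd_of_isRelPrime (fun b hb c hc hbc => hS.2 b hb c hc hbc)
      fun b hb => (hS.1 b hb).2.dvd_primX ha (hS.1 b hb).1 (hdvd b hb)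
  obtain ⟨q, hq⟩ := hprod
  have hp0 := primX_ne_zero ha
  have hq0 : q ≠ 0 := by
    rintro rfl
    exact hp0 (by rw [hq, mul_zero])
  have hS0 : ∏ b ∈ S, b ≠ 0 := Finset.prod_ne_zero_iff.mpr hne
  have hc0 : (C (contX a) : Polynomial (Rk k)) ≠ 0 := C_ne_zero.mpr (contX_ne_zero ha)
  constructor
  · rw [← natDegree_prod _ _ hne]
    refine natDegree_le_of_dvd ?_ ha
    rw [eq_C_contX_mul_primX a, hq]
    exact Dvd.intro (C (contX a) * q) (by ring)
  · intro v
    conv_rhs => rw [eq_C_contX_mul_primX a, hq, degX_mul hc0 (mul_ne_zero hS0 hq0),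
      degX_mul hS0 hq0, degX_C, degX_prod S hne]
    omega

/-- An element of an irreducible basis containing the basis `F` for the primitive part of `a`
belongs to `F` as soon as it divides `a`. -/
lemma IsBasisForPrim.mem_of_dvd {B F : Finset (Polynomial (Rk k))} {a b : Polynomial (Rk k)}
    (hB : IsIrredBasis B) (hFB : F ⊆ B) (hF : IsBasisForPrim F {a}) (ha : 0 < a.natDegree)
    (hb : b ∈ B) (hba : b ∣ a) : b ∈ F := by
  have ha0 : a ≠ 0 := by
    rintro rfl
    simp at ha
  obtain ⟨hpos, hirr⟩ := hB.1 b hb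
  have hdvd := hirr.dvd_primX ha0 hpos hba
  obtain ⟨e, he⟩ := hF.2.2 a (Finset.mem_singleton_self a) ha
  have hprod : b ∣ ∏ c ∈ F, c ^ e c := by
    rcases he with he | he <;> rw [he] at hdvd
    · exact hdvd
    · exact (dvd_neg).mp hdvd
  obtain ⟨c, hc, hbc⟩ := hirr.prime.exists_mem_finset_dvd hprod
  have hbc : b ∣ c := hirr.prime.dvd_of_dvd_pow hbc
  by_contra hbF
  have hne : b ≠ c := fun h => hbF (h ▸ hc)
  exact hirr.not_isUnit (hB.2 b hb c (hFB hc) hne dvd_rfl hbc)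

lemma IsIrredBasis.mono {B S : Finset (Polynomial (Rk k))} (hB : IsIrredBasis B)
    (hS : S ⊆ B) : IsIrredBasis S :=
  ⟨fun b hb => hB.1 b (hS hb), fun b hb c hc => hB.2 b (hS hb) c (hS hc)⟩

end ContentAndPrimitivePart

section Covers

variable {k : ℕ}

/-- The sum of the degrees in `x_v` of the elements of `S`. -/
def totalDegX (v : Fin k) (S : Finset (Rk k)) : ℕ := ∑ p ∈ S, p.degreeOf v

lemma totalDegX_mono (v : Fin k) {S T : Finset (Rk k)} (h : S ⊆ T) :
    totalDegX v S ≤ totalDegX v T :=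
  Finset.sum_le_sum_of_subset h

lemma totalDegX_union_le (v : Fin k) (S T : Finset (Rk k)) :
    totalDegX v (S ∪ T) ≤ totalDegX v S + totalDegX v T := by
  unfold totalDegX
  rw [← Finset.sum_union_inter]
  exact Nat.le_add_right _ _

lemma totalDegX_biUnion_le {ι : Type*} (v : Fin k) (s : Finset ι) (S : ι → Finset (Rk k)) :
    totalDegX v (s.biUnion S) ≤ ∑ i ∈ s, totalDegX v (S i) := by
  induction s using Finset.induction_on with
  | empty => simp [totalDegX]
  | insert a s ha ih =>
    rw [Finset.biUnion_insert, Finset.sum_insert ha]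
    exact (totalDegX_union_le v _ _).trans (Nat.add_le_add_left ih _)

lemma totalDegX_singleton (v : Fin k) (p : Rk k) : totalDegX v {p} = p.degreeOf v :=
  Finset.sum_singleton _ _

lemma totalDegX_image_le {ι : Type*} (v : Fin k) (s : Finset ι) (g : ι → Rk k) :
    totalDegX v (s.image g) ≤ ∑ i ∈ s, (g i).degreeOf v := by
  rw [← Finset.biUnion_singleton]
  exact (totalDegX_biUnion_le v s _).trans_eq (by simp only [totalDegX_singleton])

/-- `W` is covered by at most `M` sets whose elements have total degree at most `D` in each
variable. -/
def CoveredBy (M D : ℕ) (W : Finset (Rk k)) : Prop :=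
  ∃ L : Finset (Finset (Rk k)),
    L.card ≤ M ∧ W ⊆ L.sup id ∧ ∀ S ∈ L, ∀ v, totalDegX v S ≤ D

lemma CoveredBy.single {D : ℕ} {W : Finset (Rk k)} (h : ∀ v, totalDegX v W ≤ D) :
    CoveredBy 1 D W :=
  ⟨{W}, by simp, by simp, by simpa using h⟩

lemma CoveredBy.mono {M N D : ℕ} {W V : Finset (Rk k)} (h : CoveredBy M D W) (hMN : M ≤ N)
    (hV : V ⊆ W) : CoveredBy N D V := by
  obtain ⟨L, hcard, hcov, hdeg⟩ := h
  exact ⟨L, hcard.trans hMN, hV.trans hcov, hdeg⟩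

lemma CoveredBy.union {M N D : ℕ} {W V : Finset (Rk k)} (hW : CoveredBy M D W)
    (hV : CoveredBy N D V) : CoveredBy (M + N) D (W ∪ V) := by
  obtain ⟨L, hcard, hcov, hdeg⟩ := hW
  obtain ⟨L', hcard', hcov', hdeg'⟩ := hV
  refine ⟨L ∪ L', (Finset.card_union_le L L').trans (Nat.add_le_add hcard hcard'), ?_, ?_⟩
  · rw [Finset.sup_union]
    exact Finset.union_subset_union hcov hcov'
  · intro S hS
    rcases Finset.mem_union.mp hS with h | h
    exacts [hdeg S h, hdeg' S h]

lemma CoveredBy.biUnion {ι : Type*} {D : ℕ} (s : Finset ι) (M : ι → ℕ)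
    (W : ι → Finset (Rk k)) (h : ∀ i ∈ s, CoveredBy (M i) D (W i)) :
    CoveredBy (∑ i ∈ s, M i) D (s.biUnion W) := by
  induction s using Finset.induction_on with
  | empty => exact ⟨∅, by simp, by simp, by simp⟩
  | insert a s ha ih =>
    rw [Finset.biUnion_insert, Finset.sum_insert ha]
    exact (h a (Finset.mem_insert_self a s)).union
      (ih fun i hi => h i (Finset.mem_insert_of_mem hi))

lemma CoveredBy.mvHasMD {M D : ℕ} {W : Finset (Rk k)} (h : CoveredBy M D W) :
    mvHasMD M D W := by
  obtain ⟨L, hcard, hcov, hdeg⟩ := h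
  have hlabel : ∀ p ∈ W, ∃ S ∈ L, p ∈ S := fun p hp => by
    simpa [Finset.mem_sup] using hcov hp
  choose! label hlabelL hlabel using hlabel
  refine ⟨L.image fun S => W.filter fun p => label p = S,
    Finset.card_image_le.trans hcard, ?_, ?_, ?_⟩
  · intro S hS T hT hST
    obtain ⟨S', -, rfl⟩ := Finset.mem_image.mp hS
    obtain ⟨T', -, rfl⟩ := Finset.mem_image.mp hT
    rw [Finset.disjoint_left]
    intro p hp hp'
    exact hST (by rw [← (Finset.mem_filter.mp hp).2, ← (Finset.mem_filter.mp hp').2])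
  · ext p
    simp only [Finset.mem_sup, Finset.mem_image, id]
    constructor
    · rintro ⟨_, ⟨S, -, rfl⟩, hp⟩
      exact (Finset.mem_filter.mp hp).1
    · intro hp
      exact ⟨_, ⟨label p, hlabelL p hp, rfl⟩, Finset.mem_filter.mpr ⟨hp, rfl⟩⟩
  · intro S hS v
    obtain ⟨S', hS', rfl⟩ := Finset.mem_image.mp hS
    refine (MvPolynomial.degreeOf_prod_le v _ _).trans
      ((totalDegX_mono v fun p hp => ?_).trans (hdeg S' hS' v))
    obtain ⟨hpW, rfl⟩ := Finset.mem_filter.mp hp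
    exact hlabel p hpW

end Covers

section ProjectionDegrees

variable {k : ℕ}

lemma sum_product_natDegree_mul_degX (F G : Finset (Polynomial (Rk k))) (v : Fin k) :
    ∑ p ∈ F ×ˢ G, (p.2.natDegree * degX p.1 v + p.1.natDegree * degX p.2 v) =
      (∑ b ∈ G, b.natDegree) * ∑ b ∈ F, degX b v +
        (∑ b ∈ F, b.natDegree) * ∑ b ∈ G, degX b v := by
  rw [Finset.sum_add_distrib, Finset.sum_mul_sum, Finset.sum_mul_sum, Finset.sum_product_right,
    Finset.sum_product]

lemma totalDegX_crossRes_le (F G : Finset (Polynomial (Rk k))) (v : Fin k) :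
    totalDegX v (crossRes F G) ≤ (∑ b ∈ G, b.natDegree) * ∑ b ∈ F, degX b v +
        (∑ b ∈ F, b.natDegree) * ∑ b ∈ G, degX b v := by
  rw [← sum_product_natDegree_mul_degX]
  exact (totalDegX_image_le v _ _).trans
    (Finset.sum_le_sum fun p _ => degreeOf_resX_le p.1 p.2 v)

/-- Discriminants, leading coefficients and mutual resultants of the elements of `F`. -/
def discLeadRes (F : Finset (Polynomial (Rk k))) : Finset (Rk k) :=
  (F ×ˢ F).biUnion fun p =>
    if p.1 = p.2 then {discX p.1, p.1.leadingCoeff} else {resX p.1 p.2}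

lemma totalDegX_discLeadRes_le {F : Finset (Polynomial (Rk k))} (hF : ∀ b ∈ F, 0 < b.natDegree)
    (v : Fin k) :
    totalDegX v (discLeadRes F) ≤ 2 * ((∑ b ∈ F, b.natDegree) * ∑ b ∈ F, degX b v) := by
  rw [two_mul, ← sum_product_natDegree_mul_degX]
  refine (totalDegX_biUnion_le v _ _).trans (Finset.sum_le_sum fun p hp => ?_)
  obtain ⟨b, c⟩ := p
  dsimp only
  split_ifs with h
  · subst h
    rw [Finset.insert_eq, ← two_mul]
    refine (totalDegX_union_le v _ _).trans ?_
    simp only [totalDegX_singleton]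
    exact degreeOf_discX_add_leadingCoeff_le b (hF b (Finset.mem_product.mp hp).1) v
  · rw [totalDegX_singleton]
    exact degreeOf_resX_le b c v

/-- The coefficients of the elements of `F` below the leading ones. -/
def lowerCoeffs (F : Finset (Polynomial (Rk k))) : Finset (Rk k) :=
  F.biUnion fun b => (Finset.range b.natDegree).image b.coeff

lemma totalDegX_lowerCoeffs_le (F : Finset (Polynomial (Rk k))) (v : Fin k) :
    totalDegX v (lowerCoeffs F) ≤ (∑ b ∈ F, b.natDegree) * ∑ b ∈ F, degX b v := by
  rw [Finset.sum_mul]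
  refine (totalDegX_biUnion_le v _ _).trans (Finset.sum_le_sum fun b hb => ?_)
  calc totalDegX v ((Finset.range b.natDegree).image b.coeff)
      ≤ ∑ j ∈ Finset.range b.natDegree, (b.coeff j).degreeOf v := totalDegX_image_le v _ _
    _ ≤ ∑ _j ∈ Finset.range b.natDegree, degX b v :=
        Finset.sum_le_sum fun j _ => degreeOf_coeff_le_degX b v j
    _ = b.natDegree * degX b v := by simp
    _ ≤ b.natDegree * ∑ c ∈ F, degX c v :=
        Nat.mul_le_mul_left _
          (Finset.single_le_sum (f := fun c => degX c v) (fun _ _ => Nat.zero_le _) hb)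

lemma projP_subset (F : Finset (Polynomial (Rk k))) :
    projP F ⊆ discLeadRes F ∪ lowerCoeffs F := by
  intro p hp
  rcases Finset.mem_union.mp hp with hp | hp
  · rcases Finset.mem_union.mp hp with hp | hp
    · obtain ⟨b, hb, hp⟩ := Finset.mem_biUnion.mp hp
      obtain ⟨j, hj, rfl⟩ := Finset.mem_image.mp hp
      rcases (le_natDegree_of_mem_supp j hj).eq_or_lt with rfl | hlt
      · refine Finset.mem_union_left _ (Finset.mem_biUnion.mpr
          ⟨(b, b), Finset.mem_product.mpr ⟨hb, hb⟩, ?_⟩)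
        simp
      · exact Finset.mem_union_right _ (Finset.mem_biUnion.mpr
          ⟨b, hb, Finset.mem_image_of_mem _ (Finset.mem_range.mpr hlt)⟩)
    · obtain ⟨b, hb, rfl⟩ := Finset.mem_image.mp hp
      refine Finset.mem_union_left _ (Finset.mem_biUnion.mpr
        ⟨(b, b), Finset.mem_product.mpr ⟨hb, hb⟩, ?_⟩)
      simp
  · obtain ⟨q, hq, rfl⟩ := Finset.mem_image.mp hp
    obtain ⟨hq, hne⟩ := Finset.mem_filter.mp hq
    refine Finset.mem_union_left _ (Finset.mem_biUnion.mpr ⟨q, hq, ?_⟩)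
    rw [if_neg hne]
    exact Finset.mem_singleton_self _

end ProjectionDegrees

section ProjectionCovers

variable {k d : ℕ}

/-- The contents of the polynomials other than `f` and the resultants of `F` with the rest of
the basis are covered by one set for each polynomial of `A` other than `f`. -/
lemma CoveredBy.contA_union_crossRes (hd : 1 ≤ d) {A B F : Finset (Polynomial (Rk k))}
    {f : Polynomial (Rk k)}
    (hA : ∀ a ∈ A, a ≠ 0 ∧ a.natDegree ≤ d ∧ ∀ v : Fin k, degX a v ≤ d)
    (hf : f ∈ A) (hfpos : 0 < f.natDegree) (hB : IsBasisForPrim B A) (hFB : F ⊆ B)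
    (hF : IsBasisForPrim F {f}) :
    CoveredBy (A.card - 1) (2 * d ^ 2) (contA (A.erase f) ∪ crossRes F (B \ F)) := by
  have hFf : ∀ b ∈ F, b ∣ f := fun b hb => by simpa using hF.2.1 b hb
  have hboundF := hF.1.degree_bounds (hA f hf).1 hFf
  let G : Polynomial (Rk k) → Finset (Polynomial (Rk k)) := fun a =>
    (B \ F).filter fun b => b ∣ a
  have hcov := CoveredBy.biUnion (D := 2 * d ^ 2) (A.erase f) (fun _ => 1)
    (fun a => {contX a} ∪ crossRes F (G a)) fun a ha => CoveredBy.single fun v => by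
      obtain ⟨ha0, hdeg, hdegX⟩ := hA a (Finset.mem_of_mem_erase ha)
      have hGB : G a ⊆ B := (Finset.filter_subset _ _).trans Finset.sdiff_subset
      have hboundG := (hB.1.mono hGB).degree_bounds ha0 fun b hb => (Finset.mem_filter.mp hb).2
      have hGv := (hboundG.2 v).trans (hdegX v)
      have hFv := (Nat.le_add_left _ _).trans ((hboundF.2 v).trans ((hA f hf).2.2 v))
      refine (totalDegX_union_le v _ _).trans ?_
      rw [totalDegX_singleton]
      have h₁ := totalDegX_crossRes_le F (G a) v
      have h₂ := Nat.mul_le_mul (hboundG.1.trans hdeg) hFv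
      have h₃ := Nat.mul_le_mul_right (∑ b ∈ G a, degX b v)
        (hboundF.1.trans (hA f hf).2.1)
      have h₄ := Nat.mul_le_mul_left d hGv
      have h₅ := Nat.mul_le_mul_right ((contX a).degreeOf v) hd
      linarith
  refine hcov.mono (by simp [Finset.card_erase_of_mem hf]) fun p hp => ?_
  rcases Finset.mem_union.mp hp with hp | hp
  · obtain ⟨a, ha, rfl⟩ := Finset.mem_image.mp hp
    exact Finset.mem_biUnion.mpr ⟨a, ha, by simp⟩
  · obtain ⟨⟨b, c⟩, hbc, rfl⟩ := Finset.mem_image.mp hp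
    obtain ⟨hb, hc⟩ := Finset.mem_product.mp hbc
    obtain ⟨hcB, hcF⟩ := Finset.mem_sdiff.mp hc
    obtain ⟨a, ha, hca⟩ := hB.2.1 c hcB
    have haf : a ≠ f := by
      rintro rfl
      exact hcF (hF.mem_of_dvd hB.1 hFB hfpos hcB hca)
    refine Finset.mem_biUnion.mpr ⟨a, Finset.mem_erase.mpr ⟨haf, ha⟩,
      Finset.mem_union_right _ (Finset.mem_image.mpr ⟨(b, c), ?_, rfl⟩)⟩
    exact Finset.mem_product.mpr ⟨hb, Finset.mem_filter.mpr ⟨hc, hca⟩⟩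

/-- Sets of total degree at most `D` can be merged in pairs. -/
lemma CoveredBy.biUnion_pairs {t D : ℕ} (W : Fin t → Finset (Rk k))
    (hW : ∀ i v, totalDegX v (W i) ≤ D) :
    CoveredBy ((t + 1) / 2) (2 * D) (Finset.univ.biUnion W) := by
  have hcov := CoveredBy.biUnion (D := 2 * D) (Finset.range ((t + 1) / 2)) (fun _ => 1)
    (fun j => (Finset.univ.filter fun i : Fin t => (i : ℕ) / 2 = j).biUnion W)
    fun j _ => CoveredBy.single fun v => by
      have hcard : (Finset.univ.filter fun i : Fin t => (i : ℕ) / 2 = j).card ≤ 2 := by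
        rw [← Finset.card_image_of_injective _ Fin.val_injective]
        refine (Finset.card_le_card (t := {2 * j, 2 * j + 1}) fun x hx => ?_).trans
          Finset.card_le_two
        obtain ⟨i, hi, rfl⟩ := Finset.mem_image.mp hx
        have := (Finset.mem_filter.mp hi).2
        rw [Finset.mem_insert, Finset.mem_singleton]
        omega
      refine (totalDegX_biUnion_le v _ _).trans
        ((Finset.sum_le_card_nsmul _ _ D fun i _ => hW i v).trans ?_)
      exact Nat.mul_le_mul_right D hcard
  refine hcov.mono (by simp) fun p hp => ?_
  obtain ⟨i, -, hi⟩ := Finset.mem_biUnion.mp hp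
  refine Finset.mem_biUnion.mpr ⟨(i : ℕ) / 2, Finset.mem_range.mpr ?_,
    Finset.mem_biUnion.mpr ⟨i, by simp, hi⟩⟩
  have := i.isLt
  omega

lemma card_filter_fst_lt_snd (t : ℕ) :
    ((Finset.univ : Finset (Fin t × Fin t)).filter fun p => p.1 < p.2).card =
      t * (t - 1) / 2 := by
  rw [← Finset.sum_range_id, ← Fin.sum_univ_eq_sum_range fun j => j, Finset.card_filter,
    Fintype.sum_prod_type_right]
  refine Finset.sum_congr rfl fun j _ => ?_
  rw [← Finset.card_filter, ← Fin.card_Iio j]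
  congr 1
  ext i
  simp

end ProjectionCovers

/-- Let `A_1,…,A_t` be finite sets of nonzero polynomials in
`ℤ[x_1,…,x_n]` (n ≥ 2), each polynomial of degree at most `d ≥ 1` in every variable,
with `|A_1| + ⋯ + |A_t| ≤ m`, and for each `i` let `E_i = {f_i} ⊆ A_i` with `f_i` of
positive degree in `x_n`.  Then for any irreducible bases `B_i` for the primitive parts
of the `A_i` and `F_i ⊆ B_i` for the primitive parts of the `E_i`, the TTICAD projection
`P_𝓔(𝓐)` has the `(⌊(3m+1)/2⌋ + t(t−1)/2, 2d²)`-property. -/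
theorem tticad_projection_md_property_all_ec
    (k : ℕ) (hk : 1 ≤ k) (t m d : ℕ) (hd : 1 ≤ d)
    (A B F : Fin t → Finset (Polynomial (Rk k)))
    (f : Fin t → Polynomial (Rk k))
    (hA : ∀ i, ∀ a ∈ A i, a ≠ 0 ∧ a.natDegree ≤ d ∧ ∀ v : Fin k, degX a v ≤ d)
    (hm : ∑ i, (A i).card ≤ m)
    (hf : ∀ i, f i ∈ A i ∧ 0 < (f i).natDegree)
    (hB : ∀ i, IsBasisForPrim (B i) (A i))
    (hFB : ∀ i, F i ⊆ B i)
    (hF : ∀ i, IsBasisForPrim (F i) ({f i} : Finset (Polynomial (Rk k)))) :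
    mvHasMD ((3 * m + 1) / 2 + t * (t - 1) / 2) (2 * d ^ 2) (ttiProj A B F) := by
  have hFf : ∀ i, ∀ b ∈ F i, b ∣ f i := fun i b hb => by simpa using (hF i).2.1 b hb
  have hbound : ∀ i, ∑ b ∈ F i, b.natDegree ≤ d ∧
      ∀ v, (contX (f i)).degreeOf v + ∑ b ∈ F i, degX b v ≤ d := fun i => by
    obtain ⟨h0, hdeg, hdegX⟩ := hA i (f i) (hf i).1
    have h := (hF i).1.degree_bounds h0 (hFf i)
    exact ⟨h.1.trans hdeg, fun v => (h.2 v).trans (hdegX v)⟩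
  have hboundX : ∀ i v, ∑ b ∈ F i, degX b v ≤ d := fun i v =>
    (Nat.le_add_left _ _).trans ((hbound i).2 v)
  have hcardA : ∀ i, 1 ≤ (A i).card := fun i => Finset.card_pos.mpr ⟨f i, (hf i).1⟩
  have htm : t ≤ m := by
    refine le_trans ?_ hm
    simpa using Finset.sum_le_sum fun i (_ : i ∈ (Finset.univ : Finset (Fin t))) => hcardA i
  have hlocal := CoveredBy.biUnion (D := 2 * d ^ 2) Finset.univ (fun i => (A i).card)
    (fun i => (contA ((A i).erase (f i)) ∪ crossRes (F i) (B i \ F i)) ∪ discLeadRes (F i))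
    fun i _ => by
      refine CoveredBy.mono ((CoveredBy.contA_union_crossRes hd (hA i) (hf i).1 (hf i).2 (hB i)
        (hFB i) (hF i)).union (CoveredBy.single fun v => ?_))
        (Nat.sub_add_cancel (hcardA i)).le subset_rfl
      refine (totalDegX_discLeadRes_le (fun b hb => ((hF i).1.1 b hb).1) v).trans ?_
      rw [pow_two]
      exact Nat.mul_le_mul_left 2 (Nat.mul_le_mul (hbound i).1 (hboundX i v))
  have hpairs := CoveredBy.biUnion_pairs (D := d ^ 2)
    (fun i => {contX (f i)} ∪ lowerCoeffs (F i)) fun i v => by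
      refine (totalDegX_union_le v _ _).trans ?_
      rw [totalDegX_singleton]
      have h₁ := totalDegX_lowerCoeffs_le (F i) v
      have h₂ := Nat.mul_le_mul_right (∑ b ∈ F i, degX b v) (hbound i).1
      have h₃ := Nat.mul_le_mul_left d ((hbound i).2 v)
      have h₄ := Nat.mul_le_mul_right ((contX (f i)).degreeOf v) hd
      linarith
  have hcross := CoveredBy.biUnion (D := 2 * d ^ 2)
    ((Finset.univ : Finset (Fin t × Fin t)).filter fun p => p.1 < p.2) (fun _ => 1)
    (fun p => crossRes (F p.1) (F p.2)) fun p _ => CoveredBy.single fun v => by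
      have h₁ := totalDegX_crossRes_le (F p.1) (F p.2) v
      have h₂ := Nat.mul_le_mul (hbound p.2).1 (hboundX p.1 v)
      have h₃ := Nat.mul_le_mul (hbound p.1).1 (hboundX p.2 v)
      linarith
  refine (((hlocal.union hpairs).union hcross).mono ?_ ?_).mvHasMD
  · rw [Finset.sum_const, smul_eq_mul, mul_one, card_filter_fst_lt_snd]
    refine Nat.add_le_add_right ?_ _
    omega
  · refine Finset.union_subset_union (Finset.union_subset ?_ ?_) ?_
    · refine Finset.biUnion_subset.mpr fun i hi p hp => ?_
      obtain ⟨a, ha, rfl⟩ := Finset.mem_image.mp hp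
      by_cases haf : a = f i
      · exact Finset.mem_union_right _ (Finset.mem_biUnion.mpr ⟨i, hi, by simp [haf]⟩)
      · exact Finset.mem_union_left _ (Finset.mem_biUnion.mpr ⟨i, hi,
          Finset.mem_union_left _ (Finset.mem_union_left _
            (Finset.mem_image_of_mem _ (Finset.mem_erase.mpr ⟨haf, ha⟩)))⟩)
    · refine Finset.biUnion_subset.mpr fun i hi p hp => ?_
      rcases Finset.mem_union.mp hp with hp | hp
      · rcases Finset.mem_union.mp (projP_subset (F i) hp) with hp | hp
        · exact Finset.mem_union_left _ (Finset.mem_biUnion.mpr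
            ⟨i, hi, Finset.mem_union_right _ hp⟩)
        · exact Finset.mem_union_right _ (Finset.mem_biUnion.mpr
            ⟨i, hi, Finset.mem_union_right _ hp⟩)
      · exact Finset.mem_union_left _ (Finset.mem_biUnion.mpr
          ⟨i, hi, Finset.mem_union_left _ (Finset.mem_union_right _ hp)⟩)
    · exact Finset.biUnion_mono fun p _ =>
        Finset.image_subset_image (Finset.filter_subset _ _)

end
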